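/- arXiv:1804.01220 — 5 statements merged into one kernel-verified Lean document; each statement's English description precedes it below -/
import Mathlib

section
/- Let G and H be groups such that H is nontrivial and G has at least three elements. Then the free product G * H contains a non-abelian free subgroup on two generators; that is, there exists an injective group homomorphism from the free group on two generators into the free product G * H. -/
open Monoid
open scoped commutatorElement

universe u v

namespace Monoid.CoprodI.Word

open scoped Pointwise

section Monoid

variable {ι : Type*} {M : ι → Type*} [∀ i, Monoid (M i)] [DecidableEq ι] [∀ i, DecidableEq (M i)]

theorem fstIdx_of_smul {i : ι} {m : M i} {w : Word M} (hw : w.fstIdx ≠ some i) (hm : m ≠ 1) :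
    (of m • w).fstIdx = some i := by
  rw [← cons_eq_smul (h1 := hw) (h2 := hm), fstIdx_cons]

theorem exists_of_smul_eq (i : ι) (w : Word M) :
    ∃ (m : M i) (w' : Word M), w'.fstIdx ≠ some i ∧ of m • w' = w :=
  ⟨_, _, (equivPair i w).fstIdx_ne, equivPair_head_smul_equivPair_tail w⟩

theorem head_eq_of_of_smul_eq {i : ι} {m n : M i} {v w : Word M} (hv : v.fstIdx ≠ some i)
    (hw : w.fstIdx ≠ some i) (h : of m • v = of n • w) : m = n := by
  have := congrArg (fun u => (equivPair i u).head) h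
  simpa [equivPair_smul_same, equivPair_eq_of_fstIdx_ne hv, equivPair_eq_of_fstIdx_ne hw]
    using this

/-- The reduced words whose first two letters are `c` and `d`. -/
def startingWith {i j : ι} (c : M i) (d : M j) : Set (Word M) :=
  {w | ∃ v : Word M, v.fstIdx ≠ some j ∧ of c • of d • v = w}

theorem startingWith_nonempty {i j : ι} (c : M i) (d : M j) : (startingWith c d).Nonempty :=
  ⟨_, empty, by simp [fstIdx, empty], rfl⟩

variable {i j : ι} (hij : i ≠ j)
include hij

theorem fstIdx_of_mem_startingWith {c : M i} {d : M j} (hc : c ≠ 1) (hd : d ≠ 1) {w : Word M}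
    (hw : w ∈ startingWith c d) : w.fstIdx = some i := by
  obtain ⟨v, hv, rfl⟩ := hw
  exact fstIdx_of_smul (by simpa [fstIdx_of_smul hv hd] using hij.symm) hc

theorem disjoint_startingWith_swap {c c' : M i} {d d' : M j} (hc : c ≠ 1) (hc' : c' ≠ 1)
    (hd : d ≠ 1) (hd' : d' ≠ 1) : Disjoint (startingWith c d) (startingWith d' c') := by
  refine Set.disjoint_left.mpr fun w h h' => hij ?_
  simpa [fstIdx_of_mem_startingWith hij hc hd h] using
    fstIdx_of_mem_startingWith hij.symm hd' hc' h'

theorem disjoint_startingWith_of_fst_ne {c c' : M i} {d : M j} (hd : d ≠ 1) (h : c ≠ c') :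
    Disjoint (startingWith c d) (startingWith c' d) := by
  refine Set.disjoint_left.mpr ?_
  rintro w ⟨v, hv, rfl⟩ ⟨v', hv', hvv'⟩
  refine h (head_eq_of_of_smul_eq ?_ ?_ hvv'.symm)
  · simpa [fstIdx_of_smul hv hd] using hij.symm
  · simpa [fstIdx_of_smul hv' hd] using hij.symm

end Monoid

section Group

variable {ι : Type*} {M : ι → Type*} [∀ i, Group (M i)] [DecidableEq ι] [∀ i, DecidableEq (M i)]

theorem disjoint_startingWith_of_snd_ne {i j : ι} {c c' : M j} {d : M i} (h : c ≠ c') :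
    Disjoint (startingWith d c) (startingWith d c') := by
  refine Set.disjoint_left.mpr ?_
  rintro w ⟨v, hv, rfl⟩ ⟨v', hv', hvv'⟩
  exact h (head_eq_of_of_smul_eq hv hv' (smul_left_cancel _ hvv'.symm))

theorem commutator_smul_compl_startingWith_subset {i j : ι} (hij : i ≠ j) {c : M i} {d : M j}
    (hc : c ≠ 1) :
    ⁅(of c : CoprodI M), of d⁆ • (startingWith d c)ᶜ ⊆ startingWith c d := by
  rintro _ ⟨w, hw, rfl⟩
  refine ⟨of c⁻¹ • of d⁻¹ • w, ?_, by simp [commutatorElement_def, mul_smul]⟩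
  obtain ⟨k, w, hwj, rfl⟩ := exists_of_smul_eq j w
  suffices h : (of c⁻¹ • of (d⁻¹ * k) • w).fstIdx = some i by
    rw [← mul_smul (of d⁻¹), ← map_mul, h]
    simpa using hij
  by_cases hk : d⁻¹ * k = 1
  · obtain rfl : d = k := inv_mul_eq_one.mp hk
    obtain ⟨m, w, hwi, rfl⟩ := exists_of_smul_eq i w
    rw [hk, map_one, one_smul, ← mul_smul, ← map_mul]
    refine fstIdx_of_smul hwi fun hm => hw ?_
    obtain rfl : c = m := inv_mul_eq_one.mp hm
    exact ⟨w, hwi, rfl⟩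
  · refine fstIdx_of_smul ?_ (inv_ne_one.mpr hc)
    rw [fstIdx_of_smul hwj hk]
    simpa using hij.symm

end Group

end Monoid.CoprodI.Word

open CoprodI.Word in
/-- In a free product, the commutators of distinct nontrivial elements of one factor with a fixed
nontrivial element of another factor freely generate a free subgroup. -/
theorem Monoid.CoprodI.lift_commutator_injective {ι : Type} {κ : Type u} [Nontrivial κ]
    {M : ι → Type u} [∀ i, Group (M i)] {i j : ι} (hij : i ≠ j) {c : κ → M i}
    (hc : Function.Injective c) (hc1 : ∀ k, c k ≠ 1) {d : M j} (hd : d ≠ 1) :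
    Function.Injective (FreeGroup.lift fun k => ⁅(of (c k) : CoprodI M), of d⁆) := by
  classical
  refine FreeGroup.injective_lift_of_ping_pong _ (α := Word M)
    (fun k => startingWith (c k) d) (fun k => startingWith d (c k))
    (fun k => startingWith_nonempty _ _)
    (fun k l hkl => disjoint_startingWith_of_fst_ne hij hd (hc.ne hkl))
    (fun k l hkl => disjoint_startingWith_of_snd_ne (hc.ne hkl))
    (fun k l => disjoint_startingWith_swap hij (hc1 k) (hc1 l) hd hd)
    (fun k => commutator_smul_compl_startingWith_subset hij (hc1 k)) (fun k => ?_)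
  rw [Pi.inv_apply, commutatorElement_inv]
  exact commutator_smul_compl_startingWith_subset hij.symm hd

/-- `G` and `H`, lifted to a common universe, as a family indexed by `Bool`. -/
abbrev Monoid.Coprod.Factor (G : Type u) (H : Type v) (b : Bool) : Type (max u v) :=
  cond b (ULift.{v} G) (ULift.{u} H)

instance Monoid.Coprod.Factor.instGroup (G : Type u) (H : Type v) [Group G] [Group H] :
    ∀ b, Group (Factor G H b)
  | true => inferInstanceAs (Group (ULift G))
  | false => inferInstanceAs (Group (ULift H))

/-- The canonical map from the binary free product to the indexed one. -/
def Monoid.Coprod.toCoprodI (G : Type u) (H : Type v) [Group G] [Group H] :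
    Coprod G H →* CoprodI (Coprod.Factor G H) :=
  Coprod.lift
    ((CoprodI.of (M := Factor G H) (i := true)).comp (MulEquiv.ulift (α := G)).symm.toMonoidHom)
    ((CoprodI.of (M := Factor G H) (i := false)).comp (MulEquiv.ulift (α := H)).symm.toMonoidHom)

theorem Monoid.Coprod.lift_commutator_injective {κ : Type} [Nontrivial κ] {G : Type u}
    {H : Type v} [Group G] [Group H] {c : κ → G} (hc : Function.Injective c) (hc1 : ∀ k, c k ≠ 1)
    {d : H} (hd : d ≠ 1) :
    Function.Injective
      (FreeGroup.lift fun k => ⁅(inl (c k) : Coprod G H), (inr d : Coprod G H)⁆) := by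
  have key := CoprodI.lift_commutator_injective (κ := ULift.{max u v} κ) (M := Factor G H)
    (i := true) (j := false) (by decide) (c := fun k => ULift.up (c k.down))
    (fun k l h => ULift.down_injective (hc (ULift.up_injective h)))
    (fun k h => hc1 _ (ULift.up_injective h)) (d := ULift.up d)
    (fun h => hd (ULift.up_injective h))
  have hcomp := key.comp (FreeGroup.map_injective (ULift.up_injective (α := κ)))
  refine Function.Injective.of_comp (f := toCoprodI G H) ?_
  convert hcomp
  simp only [← MonoidHom.coe_comp, DFunLike.coe_fn_eq]
  ext k
  simp [toCoprodI, map_commutatorElement]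
  rfl

/-- If `H` is nontrivial and `G` has at least three elements, then the free product
`G ∗ H` contains a non-abelian free subgroup on two generators: there is an injective
group homomorphism from the free group on two generators into `G ∗ H`. -/
theorem freeProduct_contains_free_subgroup
    (G H : Type*) [Group G] [Group H] [Nontrivial H]
    (hG : ∃ x y z : G, x ≠ y ∧ x ≠ z ∧ y ≠ z) :
    ∃ φ : FreeGroup Bool →* Coprod G H, Function.Injective φ := by
  obtain ⟨d, hd⟩ := exists_ne (1 : H)
  obtain ⟨a, b, hab, ha, hb⟩ : ∃ a b : G, a ≠ b ∧ a ≠ 1 ∧ b ≠ 1 := by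
    obtain ⟨x, y, z, hxy, hxz, hyz⟩ := hG
    exact ⟨x⁻¹ * y, x⁻¹ * z, by simpa using hyz, by simpa [inv_mul_eq_one] using hxy,
      by simpa [inv_mul_eq_one] using hxz⟩
  refine ⟨_, Coprod.lift_commutator_injective (c := fun k : Bool => cond k a b) ?_ ?_ hd⟩
  · rintro (_ | _) (_ | _) h <;> simp_all [eq_comm]
  · rintro (_ | _) <;> assumption
end

section
/- Let G and H be groups such that H is nontrivial and G has at least three elements. Then the free product G * H has exponential growth: there exist elements x and y of G * H such that for every natural number n, the ball of radius n with respect to the set S = {x, x⁻¹, y, y⁻¹} has cardinality at least 3^n. -/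
open Monoid Pointwise

/-- There are `3 ^ n` lists `L` of length `n` such that `d :: L` is a reduced word in two
generators, for every letter `d`. -/
theorem FreeGroup.exists_finset_isReduced_cons (n : ℕ) (d : Bool × Bool) :
    ∃ s : Finset (List (Bool × Bool)), s.card = 3 ^ n ∧
      ∀ L ∈ s, L.length = n ∧ FreeGroup.IsReduced (d :: L) := by
  induction n generalizing d with
  | zero => exact ⟨{[]}, by simp, by simp⟩
  | succ n ih =>
    choose s hcard hs using ih
    refine ⟨(Finset.univ.erase (d.1, !d.2)).biUnion fun e ↦
      (s e).map ⟨List.cons e, List.cons_injective⟩, ?_, ?_⟩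
    · rw [Finset.card_biUnion]
      · simp [hcard, pow_succ']
      · intro e _ e' _ hne
        simp only [Finset.disjoint_left, Finset.mem_map, Function.Embedding.coeFn_mk]
        rintro _ ⟨L, _, rfl⟩ ⟨L', _, h⟩
        exact hne (List.cons_eq_cons.mp h).1.symm
    · simp only [Finset.mem_biUnion, Finset.mem_map, Function.Embedding.coeFn_mk,
        Finset.mem_erase, Finset.mem_univ, and_true]
      rintro _ ⟨e, he, L, hL, rfl⟩
      refine ⟨by simp [(hs e L hL).1],
        FreeGroup.isReduced_cons_cons.mpr ⟨fun h ↦ ?_, (hs e L hL).2⟩⟩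
      by_contra hne
      exact he (Prod.ext h.symm (by cases hd : d.2 <;> cases he' : e.2 <;> simp_all))

/-- If `x` and `y` freely generate a free group, then the balls of radius `n` with respect to
`{x, x⁻¹, y, y⁻¹}` have at least `3 ^ n` elements. -/
theorem FreeGroup.three_pow_le_card_ball {K : Type*} [Group K] (x y : K)
    (hinj : Function.Injective (FreeGroup.lift fun b : Bool ↦ cond b x y)) (n : ℕ) :
    3 ^ n ≤ Nat.card ((({x, x⁻¹, y, y⁻¹} : Set K) ∪ {1}) ^ n : Set K) := by
  obtain ⟨s, hcard, hs⟩ := FreeGroup.exists_finset_isReduced_cons n (true, true)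
  have hmem : ∀ L : List (Bool × Bool), FreeGroup.lift (fun b : Bool ↦ cond b x y)
      (FreeGroup.mk L) ∈ (({x, x⁻¹, y, y⁻¹} : Set K) ∪ {1}) ^ L.length := by
    intro L
    induction L with
    | nil => simp
    | cons e L ih =>
      rw [FreeGroup.lift_mk] at ih ⊢
      rw [List.length_cons, pow_succ', List.map_cons, List.prod_cons]
      refine Set.mul_mem_mul ?_ ih
      rcases e with ⟨_ | _, _ | _⟩ <;> simp
  have hfin : ∀ m : ℕ, ((({x, x⁻¹, y, y⁻¹} : Set K) ∪ {1}) ^ m).Finite := fun m ↦ by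
    induction m with
    | zero => simp
    | succ m ih => exact pow_succ (({x, x⁻¹, y, y⁻¹} : Set K) ∪ {1}) m ▸ ih.mul (Set.toFinite _)
  rw [Nat.card_coe_set_eq, ← hcard, ← Set.ncard_coe_finset]
  refine Set.ncard_le_ncard_of_injOn
    (fun L ↦ FreeGroup.lift (fun b : Bool ↦ cond b x y) (FreeGroup.mk L)) ?_ ?_ (hfin n)
  · intro L hL
    have := hmem L
    rwa [(hs L hL).1] at this
  · intro L hL L' hL' h
    have hred : ∀ L ∈ s, FreeGroup.reduce L = L := fun L hL ↦
      ((hs L hL).2.infix (List.suffix_cons _ L).isInfix).reduce_eq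
    rw [← hred L hL, ← hred L' hL']
    exact FreeGroup.reduce.sound (hinj h)

/-- In a free product, the commutators `a * h * a⁻¹ * h⁻¹` and `b * h * b⁻¹ * h⁻¹` freely
generate a free group if `a ≠ b` are nontrivial elements of the first factor and `h` is a
nontrivial element of the second. -/
theorem Monoid.Coprod.injective_lift_commutator {G H : Type*} [Group G] [Group H]
    {a b : G} {h : H} (ha : a ≠ 1) (hb : b ≠ 1) (hab : a ≠ b) (hh : h ≠ 1) :
    Function.Injective (FreeGroup.lift fun i : Bool ↦
      cond i (inl a * inr h * inl a⁻¹ * inr h⁻¹ : Coprod G H)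
        (inl b * inr h * inl b⁻¹ * inr h⁻¹)) := by
  classical
  let f : G × H → FreeGroup Bool := fun p ↦
    if p = (a⁻¹, h⁻¹) then (FreeGroup.of true)⁻¹
    else if p = (b⁻¹, h⁻¹) then (FreeGroup.of false)⁻¹ else 1
  have f_one_left : ∀ k, f (1, k) = 1 := fun k ↦ by simp [f, ha, hb]
  have f_one_right : ∀ g, f (g, 1) = 1 := fun g ↦ by simp [f, hh]
  have f_a : f (a⁻¹, h⁻¹) = (FreeGroup.of true)⁻¹ := by simp [f]
  have f_b : f (b⁻¹, h⁻¹) = (FreeGroup.of false)⁻¹ := by simp [f, hab.symm]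
  -- `G` and `H` act on `(G × H) × FreeGroup Bool` by translation of their own coordinate, the
  -- action of `G` being twisted by `f`.
  let ρG : G →* Equiv.Perm ((G × H) × FreeGroup Bool) :=
    { toFun := fun g ↦
        { toFun := fun p ↦ ((g * p.1.1, p.1.2), (f (g * p.1.1, p.1.2))⁻¹ * (f p.1 * p.2))
          invFun := fun p ↦ ((g⁻¹ * p.1.1, p.1.2), (f (g⁻¹ * p.1.1, p.1.2))⁻¹ * (f p.1 * p.2))
          left_inv := fun p ↦ by simp
          right_inv := fun p ↦ by simp }
      map_one' := by ext p <;> simp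
      map_mul' := fun g g' ↦ by ext p <;> simp [mul_assoc] }
  let ρH : H →* Equiv.Perm ((G × H) × FreeGroup Bool) :=
    { toFun := fun k ↦
        { toFun := fun p ↦ ((p.1.1, k * p.1.2), p.2)
          invFun := fun p ↦ ((p.1.1, k⁻¹ * p.1.2), p.2)
          left_inv := fun p ↦ by simp
          right_inv := fun p ↦ by simp }
      map_one' := by ext p <;> simp
      map_mul' := fun g g' ↦ by ext p <;> simp [mul_assoc] }
  have hG : ∀ g p, ρG g p = ((g * p.1.1, p.1.2), (f (g * p.1.1, p.1.2))⁻¹ * (f p.1 * p.2)) :=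
    fun _ _ ↦ rfl
  have hH : ∀ k p, ρH k p = ((p.1.1, k * p.1.2), p.2) := fun _ _ ↦ rfl
  let φ := Coprod.lift ρG ρH
  have commutator_apply : ∀ c v, φ (inl c * inr h * inl c⁻¹ * inr h⁻¹) ((1, 1), v) =
      ((1, 1), (f (c⁻¹, h⁻¹))⁻¹ * v) := fun c v ↦ by
    simp only [φ, map_mul, Coprod.lift_apply_inl, Coprod.lift_apply_inr,
      Equiv.Perm.mul_apply, hG, hH]
    simp [f_one_left, f_one_right]
  set ψ := FreeGroup.lift fun i : Bool ↦
    cond i (inl a * inr h * inl a⁻¹ * inr h⁻¹ : Coprod G H)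
      (inl b * inr h * inl b⁻¹ * inr h⁻¹)
  have of_apply : ∀ i v, φ (ψ (FreeGroup.of i)) ((1, 1), v) =
      ((1, 1), FreeGroup.of i * v) := by
    rintro (_ | _) v
    · rw [FreeGroup.lift_apply_of, cond_false, commutator_apply, f_b, inv_inv]
    · rw [FreeGroup.lift_apply_of, cond_true, commutator_apply, f_a, inv_inv]
  have φψ : ∀ w v, φ (ψ w) ((1, 1), v) = ((1, 1), w * v) := fun w ↦ by
    induction w using FreeGroup.induction_on with
    | C1 => simp
    | of i => exact of_apply i
    | inv_of i _ =>
      intro v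
      rw [map_inv, map_inv, Equiv.Perm.inv_eq_iff_eq, of_apply, mul_inv_cancel_left]
    | mul w w' hw hw' =>
      intro v
      rw [map_mul, map_mul, Equiv.Perm.mul_apply, hw', hw, mul_assoc]
  intro w w' hww
  have := φψ w 1
  rw [hww, φψ w' 1] at this
  simpa using this.symm

/-- If `H` is nontrivial and `G` has at least three elements, then the free product
`G ∗ H` has exponential growth: there are elements `x y` such that for every `n`,
the ball of radius `n` with respect to `{x, x⁻¹, y, y⁻¹}` has at least `3 ^ n` elements. -/
theorem freeProduct_exponential_growth
    (G H : Type*) [Group G] [Group H] [Nontrivial H]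
    (hG : ∃ x y z : G, x ≠ y ∧ x ≠ z ∧ y ≠ z) :
    ∃ x y : Coprod G H, ∀ n : ℕ,
      3 ^ n ≤ Nat.card
        (((({x, x⁻¹, y, y⁻¹} : Set (Coprod G H)) ∪ {1}) ^ n : Set (Coprod G H))) := by
  obtain ⟨h, hh⟩ := exists_ne (1 : H)
  obtain ⟨a, b, ha, hb, hab⟩ : ∃ a b : G, a ≠ 1 ∧ b ≠ 1 ∧ a ≠ b := by
    obtain ⟨x, y, z, hxy, hxz, hyz⟩ := hG
    exact ⟨x⁻¹ * y, x⁻¹ * z, by simpa [inv_mul_eq_one] using hxy,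
      by simpa [inv_mul_eq_one] using hxz, by simpa using hyz⟩
  exact ⟨_, _, FreeGroup.three_pow_le_card_ball _ _
    (Coprod.injective_lift_commutator ha hb hab hh)⟩
end

section
/- In the free group on two generators a and b, for every natural number n the ball of radius n with respect to the set S = {a, a⁻¹, b, b⁻¹} has cardinality exactly 2·3^n − 1. -/
open Pointwise

namespace FreeGroup

/-- The ball of radius `n` with respect to the letters of a free group consists of the elements
of reduced length at most `n`. -/
theorem range_mk_singleton_union_one_pow {α : Type*} [DecidableEq α] (n : ℕ) :
    (Set.range (fun p : α × Bool => mk [p]) ∪ {1}) ^ n = {x : FreeGroup α | x.norm ≤ n} := by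
  induction n with
  | zero => ext x; simp
  | succ n ih =>
    rw [pow_succ', ih]
    ext x
    simp only [Set.mem_mul, Set.mem_ofPred_eq]
    constructor
    · rintro ⟨y, hy, z, hz, rfl⟩
      have hy1 : y.norm ≤ 1 := by
        rcases hy with ⟨p, rfl⟩ | rfl
        · exact norm_mk_le
        · simp
      have := norm_mul_le y z
      omega
    · intro hx
      cases hw : x.toWord with
      | nil =>
        rw [toWord_eq_nil_iff] at hw
        exact ⟨1, Or.inr rfl, 1, by simp, by simp [hw]⟩
      | cons p L =>
        refine ⟨mk [p], Or.inl ⟨p, rfl⟩, mk L, norm_mk_le.trans ?_, ?_⟩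
        · simpa [norm, hw] using hx
        · rw [mul_mk, List.singleton_append, ← hw, mk_toWord]

/-- The letters that may follow the letter `p` in a reduced word. -/
def nextLetters (p : Bool × Bool) : Finset (Bool × Bool) :=
  {q | p.1 = q.1 → p.2 = q.2}

theorem card_nextLetters (p : Bool × Bool) : (nextLetters p).card = 3 := by
  revert p; decide

/-- The reduced words of length at most `n` whose first letter, if any, lies in `s`. -/
def reducedWords : ℕ → Finset (Bool × Bool) → Finset (List (Bool × Bool))
  | 0, _ => {[]}
  | n + 1, s => insert [] ((s.sigma fun p => reducedWords n (nextLetters p)).image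
      fun q => q.1 :: q.2)

theorem mem_reducedWords {n : ℕ} {s : Finset (Bool × Bool)} {L : List (Bool × Bool)} :
    L ∈ reducedWords n s ↔ L.length ≤ n ∧ IsReduced L ∧ ∀ p ∈ L.head?, p ∈ s := by
  induction n generalizing s L with
  | zero =>
    cases L <;> simp [reducedWords]
  | succ n ih =>
    cases L with
    | nil => simp [reducedWords]
    | cons p L =>
      have key : IsReduced (p :: L) ↔ IsReduced L ∧ ∀ q ∈ L.head?, q ∈ nextLetters p := by
        cases L <;> simp [nextLetters, isReduced_cons_cons, and_comm]
      simp only [reducedWords, Finset.mem_insert, Finset.mem_image, Finset.mem_sigma,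
        Sigma.exists, List.cons.injEq, reduceCtorEq, false_or, ih, key, List.length_cons,
        List.head?_cons, Option.mem_some_iff, Nat.add_le_add_iff_right]
      constructor
      · rintro ⟨q, M, ⟨hq, hM, hr, hh⟩, rfl, rfl⟩
        exact ⟨hM, ⟨hr, hh⟩, by rintro _ rfl; exact hq⟩
      · rintro ⟨hM, ⟨hr, hh⟩, hp⟩
        exact ⟨p, L, ⟨hp p rfl, hM, hr, hh⟩, rfl, rfl⟩

theorem two_mul_card_reducedWords (n : ℕ) (s : Finset (Bool × Bool)) :
    2 * (reducedWords n s).card + s.card = 2 + s.card * 3 ^ n := by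
  induction n generalizing s with
  | zero => simp [reducedWords]
  | succ n ih =>
    have hsum : 2 * ∑ p ∈ s, (reducedWords n (nextLetters p)).card + s.card * 3
        = s.card * (2 + 3 * 3 ^ n) := by
      rw [Finset.mul_sum, ← smul_eq_mul s.card, ← Finset.sum_const, ← Finset.sum_add_distrib,
        ← smul_eq_mul s.card, ← Finset.sum_const]
      refine Finset.sum_congr rfl fun p _ => ?_
      simpa only [card_nextLetters] using ih (nextLetters p)
    have hinj : Function.Injective
        (fun q : (_ : Bool × Bool) × List (Bool × Bool) => q.1 :: q.2) := by
      rintro ⟨p, L⟩ ⟨q, M⟩ h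
      simpa using h
    rw [reducedWords, Finset.card_insert_of_notMem (by simp),
      Finset.card_image_of_injective _ hinj, Finset.card_sigma]
    rw [pow_succ]
    linarith

end FreeGroup

/-- In the free group on two generators `a = of true` and `b = of false`, the ball of
radius `n` with respect to `{a, a⁻¹, b, b⁻¹}` has exactly `2 * 3 ^ n - 1` elements. -/
theorem freeGroup_ball_card (n : ℕ) :
    Nat.card (((({FreeGroup.of true, (FreeGroup.of true)⁻¹,
        FreeGroup.of false, (FreeGroup.of false)⁻¹} : Set (FreeGroup Bool)) ∪ {1}) ^ n :
        Set (FreeGroup Bool))) = 2 * 3 ^ n - 1 := by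
  have hS : ({FreeGroup.of true, (FreeGroup.of true)⁻¹, FreeGroup.of false,
      (FreeGroup.of false)⁻¹} : Set (FreeGroup Bool)) =
      Set.range fun p : Bool × Bool => FreeGroup.mk [p] := by
    ext x
    simp [FreeGroup.of, FreeGroup.invRev, eq_comm]
    tauto
  have himage : FreeGroup.toWord '' {x : FreeGroup Bool | x.norm ≤ n} =
      (FreeGroup.reducedWords n Finset.univ : Set (List (Bool × Bool))) := by
    ext L
    simp only [Set.mem_image, Set.mem_ofPred_eq, Finset.mem_coe, FreeGroup.mem_reducedWords,
      Finset.mem_univ, implies_true, and_true]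
    constructor
    · rintro ⟨x, hx, rfl⟩
      exact ⟨hx, FreeGroup.isReduced_toWord⟩
    · rintro ⟨hL, hr⟩
      exact ⟨FreeGroup.mk L, FreeGroup.norm_mk_le.trans hL, by
        rw [FreeGroup.toWord_mk, hr.reduce_eq]⟩
  rw [hS, FreeGroup.range_mk_singleton_union_one_pow, Nat.card_coe_set_eq,
    ← Set.ncard_image_of_injective _ FreeGroup.toWord_injective, himage, Set.ncard_coe_finset]
  have hcard := FreeGroup.two_mul_card_reducedWords n Finset.univ
  have huniv : (Finset.univ : Finset (Bool × Bool)).card = 4 := rfl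
  rw [huniv] at hcard
  omega
end

section
/- Let G and H be groups such that H is nontrivial and G has at least three elements. Then the free product G * H has no nilpotent subgroup of finite index; in particular it has no abelian subgroup of finite index. -/
open Monoid

namespace Monoid.CoprodI

variable {ι : Type*} {M : ι → Type*}

section Monoid

variable [∀ i, Monoid (M i)]

theorem NeWord.head_index_eq_of_prod_eq {i j k l : ι} (v : NeWord M i j) (w : NeWord M k l)
    (h : v.prod = w.prod) : i = k := by
  classical
  have hw : v.toWord = w.toWord := Word.equiv.symm.injective h
  have hl : v.toList = w.toList := congrArg Word.toList hw
  have hh := v.toList_head?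
  rw [hl, w.toList_head?, Option.some_inj] at hh
  exact (congrArg Sigma.fst hh).symm

theorem NeWord.exists_prod_eq {z : CoprodI M} (hz : z ≠ 1) :
    ∃ (i j : ι) (w : NeWord M i j), w.prod = z := by
  classical
  obtain ⟨w, rfl⟩ := Word.equiv.symm.surjective z
  obtain ⟨i, j, v, rfl⟩ := NeWord.of_word w (by rintro rfl; exact hz Word.prod_empty)
  exact ⟨i, j, v, rfl⟩

/-- A power of an alternating product `h * c`, followed by one more `h`, is reduced. -/
theorem NeWord.exists_prod_eq_pow_mul {i j : ι} (hij : i ≠ j) {h : M j} (hh : h ≠ 1) {c : M i}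
    (hc : c ≠ 1) (n : ℕ) :
    ∃ w : NeWord M j j, w.prod = (of h * of c) ^ n * of h := by
  induction n with
  | zero => exact ⟨.singleton h hh, by simp⟩
  | succ n ih =>
    obtain ⟨w, hw⟩ := ih
    refine ⟨.append (.append (.singleton h hh) hij.symm (.singleton c hc)) hij w, ?_⟩
    simp [hw, pow_succ', mul_assoc]

end Monoid

variable [∀ i, Group (M i)]

theorem NeWord.exists_prod_eq_conj_pow {i j : ι} (hij : i ≠ j) {h : M j} (hh : h ≠ 1) {a c : M i}
    (ha : a ≠ 1) (hc : c ≠ 1) (hac : a ≠ c) {n : ℕ} (hn : n ≠ 0) :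
    ∃ w : NeWord M i i, w.prod = (of a * (of h * of c) * (of a)⁻¹) ^ n := by
  obtain ⟨n, rfl⟩ := Nat.exists_eq_succ_of_ne_zero hn
  obtain ⟨w, hw⟩ := NeWord.exists_prod_eq_pow_mul hij hh hc n
  have hca : c * a⁻¹ ≠ 1 := fun e ↦ hac (mul_inv_eq_one.mp e).symm
  refine ⟨.append (.append (.singleton a ha) hij w) hij.symm (.singleton (c * a⁻¹) hca), ?_⟩
  rw [conj_pow, pow_succ]
  simp [hw, mul_assoc]

/-- A nontrivial normal subgroup of a free product contains a reduced word neither beginning nor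
ending in a given factor with at least three elements. -/
theorem NeWord.exists_prod_mem_of_normal {i j : ι} (hij : i ≠ j) {h : M j} (hh : h ≠ 1) {a c : M i}
    (ha : a ≠ 1) (hc : c ≠ 1) (hac : a ≠ c) {N : Subgroup (CoprodI M)} [N.Normal] {z : CoprodI M}
    (hzN : z ∈ N) (hz : z ≠ 1) :
    ∃ (k l : ι) (w : NeWord M k l), k ≠ i ∧ l ≠ i ∧ w.prod ∈ N := by
  have both (w : NeWord M i i) (hw : w.prod ∈ N) :
      ∃ (k l : ι) (w : NeWord M k l), k ≠ i ∧ l ≠ i ∧ w.prod ∈ N := by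
    refine ⟨j, j, .append (.append (.singleton h hh) hij.symm w) hij
      (.singleton h⁻¹ (inv_ne_one.mpr hh)), hij.symm, hij.symm, ?_⟩
    simpa using Subgroup.Normal.conj_mem ‹_› _ hw (of h)
  have left {l : ι} (hl : l ≠ i) (w : NeWord M i l) (hw : w.prod ∈ N) :
      ∃ (k l : ι) (w : NeWord M k l), k ≠ i ∧ l ≠ i ∧ w.prod ∈ N := by
    obtain ⟨x, hx, hxw⟩ : ∃ x : M i, x ≠ 1 ∧ x * w.head ≠ 1 := by
      by_cases e : a * w.head = 1
      · exact ⟨c, hc, fun e' ↦ hac (mul_right_cancel (e.trans e'.symm))⟩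
      · exact ⟨a, ha, e⟩
    refine both (.append (w.mulHead x hxw) hl (.singleton x⁻¹ (inv_ne_one.mpr hx))) ?_
    simpa using Subgroup.Normal.conj_mem ‹_› _ hw (of x)
  obtain ⟨k, l, w, rfl⟩ := NeWord.exists_prod_eq hz
  by_cases hk : k = i
  · subst hk
    by_cases hl : l = k
    · subst hl
      exact both w hzN
    · exact left hl w hzN
  · by_cases hl : l = i
    · subst hl
      exact left hk w.inv (by simpa using N.inv_mem hzN)
    · exact ⟨k, l, w, hk, hl, hzN⟩

/-- In a free product with two nontrivial factors, one of which has at least three elements,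
only the identity commutes with all `n`-th powers. -/
theorem eq_one_of_forall_commute_pow {i j : ι} (hij : i ≠ j) {h : M j} (hh : h ≠ 1) {a c : M i}
    (ha : a ≠ 1) (hc : c ≠ 1) (hac : a ≠ c) {n : ℕ} (hn : n ≠ 0) {z : CoprodI M}
    (hz : ∀ g : CoprodI M, Commute (g ^ n) z) : z = 1 := by
  by_contra hz1
  let P : Set (CoprodI M) := Set.range (· ^ n)
  have hP (g : CoprodI M) {x : CoprodI M} (hx : x ∈ P) : g⁻¹ * x * g ∈ P := by
    obtain ⟨y, rfl⟩ := hx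
    exact ⟨g⁻¹ * y * g, by simpa using conj_pow (i := n) (a := g⁻¹) (b := y)⟩
  have : (Subgroup.centralizer P).Normal := by
    refine ⟨fun x hx g ↦ Subgroup.mem_centralizer_iff.mpr fun y hy ↦ ?_⟩
    have := Subgroup.mem_centralizer_iff.mp hx _ (hP g hy)
    calc y * (g * x * g⁻¹) = g * (g⁻¹ * y * g * x) * g⁻¹ := by group
      _ = g * x * g⁻¹ * y := by rw [this]; group
  obtain ⟨k, l, w, hk, hl, hw⟩ := NeWord.exists_prod_mem_of_normal hij hh ha hc hac
    (N := Subgroup.centralizer P)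
    (Subgroup.mem_centralizer_iff.mpr (by rintro _ ⟨g, rfl⟩; exact hz g)) hz1
  obtain ⟨v, hv⟩ := NeWord.exists_prod_eq_conj_pow hij hh ha hc hac hn
  refine hk (NeWord.head_index_eq_of_prod_eq (v.append hk.symm w) (w.append hl v) ?_).symm
  rw [NeWord.append_prod, NeWord.append_prod]
  exact Subgroup.mem_centralizer_iff.mp hw _ ⟨_, hv.symm⟩

end Monoid.CoprodI

namespace Monoid.Coprod

universe u v

/-- The two factors of a binary free product, lifted to a common universe. -/
abbrev Factor_s4 (G : Type u) (H : Type v) : Bool → Type (max u v)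
  | true => ULift.{v} G
  | false => ULift.{u} H

instance (G : Type u) (H : Type v) [Group G] [Group H] : ∀ b, Group (Factor_s4 G H b)
  | true => inferInstanceAs (Group (ULift.{v} G))
  | false => inferInstanceAs (Group (ULift.{u} H))

/-- The binary free product as an indexed free product. -/
def equivCoprodI (G : Type u) (H : Type v) [Group G] [Group H] :
    Coprod G H ≃* CoprodI (Factor_s4 G H) :=
  MonoidHom.toMulEquiv
    (Coprod.lift
      ((CoprodI.of (M := Factor_s4 G H) (i := true)).comp MulEquiv.ulift.symm.toMonoidHom)
      ((CoprodI.of (M := Factor_s4 G H) (i := false)).comp MulEquiv.ulift.symm.toMonoidHom))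
    (CoprodI.lift fun
      | true => Coprod.inl.comp MulEquiv.ulift.toMonoidHom
      | false => Coprod.inr.comp MulEquiv.ulift.toMonoidHom)
    (by
      ext x
      · exact CoprodI.lift_of _ _
      · exact CoprodI.lift_of _ _)
    (by
      ext b x
      cases b <;> simp)

theorem eq_one_of_forall_commute_pow {G H : Type*} [Group G] [Group H] [Nontrivial H]
    (hG : ∃ x y z : G, x ≠ y ∧ x ≠ z ∧ y ≠ z) {n : ℕ} (hn : n ≠ 0) {z : Coprod G H}
    (hz : ∀ g : Coprod G H, Commute (g ^ n) z) : z = 1 := by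
  obtain ⟨x, a, c, hxa, hxc, hac⟩ := hG
  obtain ⟨h, hh⟩ := exists_ne (1 : H)
  let e := equivCoprodI G H
  refine (map_eq_one_iff e e.injective).mp ?_
  refine CoprodI.eq_one_of_forall_commute_pow (M := Factor_s4 G H) (i := true) (j := false)
    (by decide) (h := ULift.up h) (a := ULift.up (x⁻¹ * a)) (c := ULift.up (x⁻¹ * c))
    (fun t ↦ hh (congrArg ULift.down t))
    (fun t ↦ hxa (inv_mul_eq_one.mp (congrArg ULift.down t)))
    (fun t ↦ hxc (inv_mul_eq_one.mp (congrArg ULift.down t)))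
    (fun t ↦ hac (mul_left_cancel (congrArg ULift.down t))) hn fun g ↦ ?_
  obtain ⟨g, rfl⟩ := e.surjective g
  rw [← map_pow]
  exact (hz g).map e

theorem centralizer_eq_bot_of_finiteIndex {G H : Type*} [Group G] [Group H] [Nontrivial H]
    (hG : ∃ x y z : G, x ≠ y ∧ x ≠ z ∧ y ≠ z) (A : Subgroup (Coprod G H)) [A.FiniteIndex] :
    Subgroup.centralizer (A : Set (Coprod G H)) = ⊥ := by
  refine (Subgroup.eq_bot_iff_forall _).mpr fun z hz ↦ ?_
  exact eq_one_of_forall_commute_pow hG (Subgroup.FiniteIndex.index_ne_zero (H := A.normalCore))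
    fun g ↦ Subgroup.mem_centralizer_iff.mp hz _
      (A.normalCore_le (A.normalCore.pow_index_mem g))

end Monoid.Coprod

/-- If `H` is nontrivial and `G` has at least three elements, then the free product
`G ∗ H` has no nilpotent subgroup of finite index; in particular it has no abelian
subgroup of finite index. -/
theorem freeProduct_no_finiteIndex_nilpotent_subgroup
    (G H : Type*) [Group G] [Group H] [Nontrivial H]
    (hG : ∃ x y z : G, x ≠ y ∧ x ≠ z ∧ y ≠ z) :
    (¬ ∃ A : Subgroup (Coprod G H), A.FiniteIndex ∧ Group.IsNilpotent A) ∧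
    (¬ ∃ A : Subgroup (Coprod G H), A.FiniteIndex ∧ ∀ x ∈ A, ∀ y ∈ A, x * y = y * x) := by
  have ne_bot_of_finiteIndex (A : Subgroup (Coprod G H)) (hA : A.FiniteIndex) : A ≠ ⊥ := by
    rintro rfl
    obtain ⟨h, hh⟩ := exists_ne (1 : H)
    have hmem : (Coprod.inr h : Coprod G H) ∈
        Subgroup.centralizer ((⊥ : Subgroup (Coprod G H)) : Set (Coprod G H)) := by
      simp [Subgroup.mem_centralizer_iff]
    rw [Coprod.centralizer_eq_bot_of_finiteIndex hG, Subgroup.mem_bot] at hmem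
    exact hh (Coprod.inr_injective (hmem.trans (map_one _).symm))
  constructor
  · rintro ⟨A, hA, hnil⟩
    have : Nontrivial A := (Subgroup.nontrivial_iff_ne_bot A).mpr (ne_bot_of_finiteIndex A hA)
    refine Group.IsNilpotent.center_ne_bot (G := A) ((Subgroup.eq_bot_iff_forall _).mpr ?_)
    intro z hz
    have hmem : (z : Coprod G H) ∈ Subgroup.centralizer (A : Set (Coprod G H)) :=
      Subgroup.mem_centralizer_iff.mpr fun y hy ↦
        congrArg Subtype.val (Subgroup.mem_center_iff.mp hz ⟨y, hy⟩)
    rw [Coprod.centralizer_eq_bot_of_finiteIndex hG, Subgroup.mem_bot] at hmem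
    exact Subtype.ext hmem
  · rintro ⟨A, hA, hcomm⟩
    refine ne_bot_of_finiteIndex A hA (le_bot_iff.mp ?_)
    rw [← Coprod.centralizer_eq_bot_of_finiteIndex hG A]
    exact fun x hx ↦ Subgroup.mem_centralizer_iff.mpr fun y hy ↦ hcomm y hy x hx
end

section
/- Let G be a group generated by a finite set S, and suppose G contains an abelian subgroup of finite index. Then G has polynomial growth: there exist a constant C and a natural number d such that for every natural number n, the ball of radius n with respect to S has cardinality at most C·(n+1)^d. -/
open Pointwise

/-- In a commutative monoid, an element of `U ^ n` is a product of powers of the elements of `U`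
with exponents at most `n`. -/
theorem Finset.exists_prod_pow_of_mem_pow {M : Type*} [CommMonoid M] (U : Finset M) (n : ℕ) :
    ∀ x ∈ (U : Set M) ^ n, ∃ f : U → Fin (n + 1), ∏ u : U, (u : M) ^ (f u : ℕ) = x := by
  classical
  induction n with
  | zero =>
    intro x hx
    rw [pow_zero, Set.mem_one] at hx
    exact ⟨0, by simp [hx]⟩
  | succ n ih =>
    intro x hx
    rw [pow_succ] at hx
    obtain ⟨y, hy, u, hu, rfl⟩ := hx
    obtain ⟨f, rfl⟩ := ih y hy
    refine ⟨fun v => ⟨f v + if v = ⟨u, hu⟩ then 1 else 0, ?_⟩, ?_⟩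
    · have := (f v).isLt
      split_ifs <;> omega
    · simp only [pow_add, Finset.prod_mul_distrib]
      congr 1
      simp [pow_ite]

/-- A finite subset of a commutative monoid has polynomially growing powers. -/
theorem Finset.ncard_pow_le_of_commMonoid {M : Type*} [CommMonoid M] (U : Finset M) (n : ℕ) :
    ((U : Set M) ^ n).ncard ≤ (n + 1) ^ U.card := by
  calc ((U : Set M) ^ n).ncard
      ≤ (Set.range fun f : U → Fin (n + 1) => ∏ u : U, (u : M) ^ (f u : ℕ)).ncard :=
        Set.ncard_le_ncard (U.exists_prod_pow_of_mem_pow n) (Set.finite_range _)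
    _ ≤ Nat.card (U → Fin (n + 1)) := Finite.card_range_le _
    _ = (n + 1) ^ U.card := by
      rw [Nat.card_fun, Nat.card_fin, Nat.card_eq_fintype_card, Fintype.card_coe]

/-- If `R` is a finite right transversal of `H` and `T` is finite, then all powers of `T` are
covered by the products of the powers of some finite subset of `H` with `R`. -/
theorem Subgroup.IsComplement.exists_finset_pow_subset {G : Type*} [Group G] {H : Subgroup G}
    {R T : Set G} (hR : IsComplement (H : Set G) R) (hR1 : (1 : G) ∈ R) (hRfin : R.Finite)
    (hT : T.Finite) :
    ∃ U : Finset H, ∀ n : ℕ,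
      T ^ n ⊆ Set.image2 (fun (a : H) (r : G) => (a : G) * r) ((U : Set H) ^ n) R := by
  let p : G → G → H := fun r t =>
    ⟨r * t * (hR.toRightFun (r * t) : G)⁻¹, hR.mul_inv_toRightFun_mem (r * t)⟩
  have hU : (Set.image2 p R T).Finite := hRfin.image2 p hT
  refine ⟨hU.toFinset, fun n => ?_⟩
  rw [hU.coe_toFinset]
  induction n with
  | zero =>
    intro x hx
    rw [pow_zero, Set.mem_one] at hx
    exact ⟨1, by simp, 1, hR1, by simp [hx]⟩
  | succ n ih =>
    intro x hx
    rw [pow_succ] at hx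
    obtain ⟨y, hy, t, ht, rfl⟩ := hx
    obtain ⟨a, ha, r, hr, rfl⟩ := ih hy
    refine ⟨a * p r t, ?_, hR.toRightFun (r * t), (hR.toRightFun (r * t)).2, ?_⟩
    · rw [pow_succ]
      exact Set.mul_mem_mul ha (Set.mem_image2_of_mem hr ht)
    · simp [p, mul_assoc]

/-- A group generated by a finite set `S` which contains an abelian subgroup of finite
index has polynomial growth: the ball of radius `n` with respect to `S` has at most
`C * (n + 1) ^ d` elements, for some constants `C` and `d`. -/
theorem polynomial_growth_of_finiteIndex_abelian_subgroup
    (G : Type*) [Group G] (S : Finset G) (hS : Subgroup.closure (S : Set G) = ⊤)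
    (hab : ∃ A : Subgroup G, A.FiniteIndex ∧ ∀ x ∈ A, ∀ y ∈ A, x * y = y * x) :
    ∃ (C d : ℕ), ∀ n : ℕ,
      Nat.card ((((S : Set G) ∪ {1}) ^ n : Set G)) ≤ C * (n + 1) ^ d := by
  obtain ⟨A, hA, hcomm⟩ := hab
  let _ : CommGroup A :=
    { (inferInstance : Group A) with
      mul_comm := fun x y => Subtype.ext (hcomm x x.2 y y.2) }
  obtain ⟨R, hR, hR1⟩ := A.exists_isComplement_right 1
  have hRfin : R.Finite := hR.finite_right_iff.mpr hA
  obtain ⟨U, hU⟩ := hR.exists_finset_pow_subset hR1 hRfin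
    (S.finite_toSet.union (Set.finite_singleton 1))
  refine ⟨R.ncard, U.card, fun n => ?_⟩
  have hfin : ((U : Set A) ^ n).Finite := by
    classical
    exact_mod_cast (U ^ n).finite_toSet
  rw [Nat.card_coe_set_eq, mul_comm]
  calc _ ≤ _ := Set.ncard_le_ncard (hU n) (hfin.image2 _ hRfin)
    _ ≤ ((U : Set A) ^ n).ncard * R.ncard := by
      rw [← Set.image_prod, ← Set.ncard_prod]
      exact Set.ncard_image_le (hfin.prod hRfin)
    _ ≤ (n + 1) ^ U.card * R.ncard := Nat.mul_le_mul_right _ (U.ncard_pow_le_of_commMonoid n)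
end
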